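/- arXiv:2510.05499 — 2 statements merged into one kernel-verified Lean document; each statement's English description precedes it below -/
import Mathlib

section
/- Let B be a reflexive Banach space and f : B → B a C¹ diffeomorphism satisfying the C¹ regularity conditions and a generalized (C,λ)-structure. Then f satisfies the Lipschitz shadowing property: there exist M, d₀ > 0 such that for any d < d₀ and any d-pseudotrajectory {y_k}_{k∈ℤ} of f there exists an exact trajectory {x_k}_{k∈ℤ} (x_{k+1} = f(x_k)) with |x_k − y_k| ≤ Md for all k ∈ ℤ. -/
open Set Filter

noncomputable section

variable {B : Type*} [NormedAddCommGroup B] [NormedSpace ℝ B] [CompleteSpace B]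

/-- Iterated differential of `f` along the forward orbit of `x`:
`orbitDeriv f Df n x = Df(f^{n-1} x) ∘ ⋯ ∘ Df(x)`. -/
def orbitDeriv (f : B → B) (Df : B → B →L[ℝ] B) : ℕ → B → B →L[ℝ] B
  | 0, _ => ContinuousLinearMap.id ℝ B
  | (n + 1), x => orbitDeriv f Df n (f x) ∘L Df x

/-- `f` is a `C¹` diffeomorphism with inverse `fInv`, derivative `Df` and
derivative of the inverse `DfInv`. -/
def IsC1Diffeo (f fInv : B → B) (Df DfInv : B → B →L[ℝ] B) : Prop :=
  Function.LeftInverse fInv f ∧ Function.RightInverse fInv f ∧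
  (∀ x, HasFDerivAt f (Df x) x) ∧ (∀ x, HasFDerivAt fInv (DfInv x) x)

/-- The `C¹` regularity conditions (uniform continuity and boundedness of `Df`). -/
def C1Reg (f : B → B) (Df DfInv : B → B →L[ℝ] B) (R : ℝ) (r : ℝ → ℝ) : Prop :=
  0 < R ∧ MonotoneOn r (Set.Ici 0) ∧ (∀ z, 0 ≤ z → 0 ≤ r z) ∧
  Filter.Tendsto r (nhdsWithin 0 (Set.Ioi 0)) (nhds 0) ∧
  (∀ x v : B, ‖f (x + v) - f x - Df x v‖ ≤ ‖v‖ * r ‖v‖) ∧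
  (∀ x : B, ‖Df x‖ ≤ R) ∧ (∀ x : B, ‖DfInv x‖ ≤ R) ∧
  (∀ x v : B, ‖Df (x + v) - Df x‖ ≤ r ‖v‖)

/-- Generalized `(C, λ)`-structure for a diffeomorphism `f`, with stable/unstable
projections `P x`, `Q x` (no continuity in `x` assumed). -/
def IsGenCL (f fInv : B → B) (Df DfInv : B → B →L[ℝ] B)
    (C lam : ℝ) (P Q : B → B →L[ℝ] B) : Prop :=
  (∀ x, P x + Q x = ContinuousLinearMap.id ℝ B) ∧
  (∀ x, ‖P x‖ ≤ C) ∧ (∀ x, ‖Q x‖ ≤ C) ∧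
  (∀ x, Set.MapsTo (Df x) (Set.range (P x)) (Set.range (P (f x)))) ∧
  (∀ x, Set.MapsTo (DfInv x) (Set.range (Q x)) (Set.range (Q (fInv x)))) ∧
  (∀ x (n : ℕ) (v : B), v ∈ Set.range (P x) →
      ‖orbitDeriv f Df n x v‖ ≤ C * lam ^ n * ‖v‖) ∧
  (∀ x (n : ℕ) (v : B), v ∈ Set.range (Q x) →
      ‖orbitDeriv fInv DfInv n x v‖ ≤ C * lam ^ n * ‖v‖)

/-- For an interval `I ⊆ ℤ`, `tildeI I = {k : k ∈ I and k+1 ∈ I}`. -/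
def tildeI (I : Set ℤ) : Set ℤ := {k | k ∈ I ∧ k + 1 ∈ I}

/-- Bounded solution property on `I` with constant `L`. -/
def BSP (I : Set ℤ) (A : ℤ → B →L[ℝ] B) (L : ℝ) : Prop :=
  ∀ w : ℤ → B, (∀ k ∈ tildeI I, ‖w (k + 1)‖ ≤ 1) →
    ∃ v : ℤ → B, (∀ k ∈ I, ‖v k‖ ≤ L) ∧ ∀ k ∈ tildeI I, v (k + 1) = A k (v k) + w (k + 1)

/-- Strong bounded solution property on `I` with constant `L`: the difference
operator `T_A : ℓ^∞(I,B) → ℓ^∞(Ĩ,B)` has a bounded linear right inverse of norm `≤ L`. -/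
def StrongBSP (I : Set ℤ) (A : ℤ → B →L[ℝ] B) (L : ℝ) : Prop :=
  ∃ S : BoundedContinuousFunction ℤ B →L[ℝ] BoundedContinuousFunction ℤ B,
    (∀ (w : BoundedContinuousFunction ℤ B) (M : ℝ),
        (∀ k ∈ tildeI I, ‖w (k + 1)‖ ≤ M) → ∀ k ∈ I, ‖S w k‖ ≤ L * M) ∧
    (∀ w : BoundedContinuousFunction ℤ B, ∀ k ∈ tildeI I,
        S w (k + 1) = A k (S w k) + w (k + 1))

theorem orbitDeriv_succ_left {B : Type*} [NormedAddCommGroup B] [NormedSpace ℝ B]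
    (f : B → B) (Df : B → B →L[ℝ] B) (n : ℕ) (x : B) :
    orbitDeriv f Df (n + 1) x = Df (f^[n] x) ∘L orbitDeriv f Df n x := by
  induction n generalizing x with
  | zero => ext v; simp [orbitDeriv]
  | succ n ih =>
    rw [orbitDeriv, ih (f x)]
    rfl

theorem iterate_orbit_sub {B : Type*}
    {f : B → B} {z : ℤ → B} (hz : ∀ k, z (k + 1) = f (z k))
    (k : ℤ) (n : ℕ) : f^[n] (z (k - n)) = z k := by
  induction n generalizing k with
  | zero => simp
  | succ n ih =>
    rw [Function.iterate_succ_apply, ← hz]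
    convert ih k using 3
    push_cast
    ring

/-- If the forcing term decays exponentially under forward transport along an orbit, then the
inhomogeneous linear equation along this orbit has a bounded solution. -/
theorem exists_bounded_solution_of_orbitDeriv_decay {f : B → B} {Df : B → B →L[ℝ] B}
    {z : ℤ → B} (hz : ∀ k, z (k + 1) = f (z k)) {lam K : ℝ} (hlam : lam ∈ Ioo (0 : ℝ) 1)
    {c : ℤ → B} (hc : ∀ k n, ‖orbitDeriv f Df n (z k) (c k)‖ ≤ K * lam ^ n) :
    ∃ s : ℤ → B, (∀ k, ‖s k‖ ≤ K * (1 - lam)⁻¹) ∧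
      ∀ k, s (k + 1) = Df (z k) (s k) + c (k + 1) := by
  let t : ℤ → ℕ → B := fun k n ↦ orbitDeriv f Df n (z (k - n)) (c (k - n))
  have hgeom : HasSum (fun n : ℕ ↦ K * lam ^ n) (K * (1 - lam)⁻¹) :=
    (hasSum_geometric_of_lt_one hlam.1.le hlam.2).mul_left K
  have hsum : ∀ k, Summable (t k) := fun k ↦
    Summable.of_norm_bounded hgeom.summable fun n ↦ hc (k - n) n
  have hstep : ∀ k n, t (k + 1) (n + 1) = Df (z k) (t k n) := by
    intro k n
    have e : k + 1 - ((n + 1 : ℕ) : ℤ) = k - n := by push_cast; ring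
    simp only [t, e]
    rw [orbitDeriv_succ_left, iterate_orbit_sub hz]
    rfl
  refine ⟨fun k ↦ ∑' n, t k n, fun k ↦ tsum_of_norm_bounded hgeom fun n ↦ hc (k - n) n,
    fun k ↦ ?_⟩
  change ∑' n, t (k + 1) n = _
  rw [(hsum (k + 1)).tsum_eq_zero_add, (Df (z k)).map_tsum (hsum k)]
  simp only [hstep]
  simp [t, orbitDeriv, add_comm]

theorem IsC1Diffeo.comp_deriv_inv {B : Type*} [NormedAddCommGroup B] [NormedSpace ℝ B]
    {f fInv : B → B} {Df DfInv : B → B →L[ℝ] B}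
    (hf : IsC1Diffeo f fInv Df DfInv) (x v : B) : Df x (DfInv (f x) v) = v := by
  obtain ⟨hl, hr, hd, hdi⟩ := hf
  have h₁ : HasFDerivAt (f ∘ fInv) (Df x ∘L DfInv (f x)) (f x) :=
    HasFDerivAt.comp (f x) (by rw [hl x]; exact hd x) (hdi (f x))
  have h₂ : HasFDerivAt (f ∘ fInv) (ContinuousLinearMap.id ℝ B) (f x) := by
    rw [show f ∘ fInv = id from funext hr]
    exact hasFDerivAt_id _
  exact DFunLike.congr_fun (h₁.unique h₂) v

/-- Bounded solutions of the inhomogeneous linear equation along exact orbits, with a constant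
which depends only on the generalized `(C, lam)`-structure. -/
theorem IsGenCL.exists_bounded_solution {f fInv : B → B} {Df DfInv : B → B →L[ℝ] B}
    (hf : IsC1Diffeo f fInv Df DfInv) {C lam : ℝ} (hC : 0 < C) (hlam : lam ∈ Ioo (0 : ℝ) 1)
    {P Q : B → B →L[ℝ] B} (hCL : IsGenCL f fInv Df DfInv C lam P Q)
    {z : ℤ → B} (hz : ∀ k, z (k + 1) = f (z k)) {ε : ℝ} {w : ℤ → B} (hw : ∀ k, ‖w k‖ ≤ ε) :
    ∃ v : ℤ → B, (∀ k, ‖v k‖ ≤ (2 * C ^ 2 * (1 - lam)⁻¹ + C) * ε) ∧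
      ∀ k, v (k + 1) = Df (z k) (v k) + w (k + 1) := by
  obtain ⟨hPQ, hP, hQ, -, -, hs, hu⟩ := hCL
  have bound : ∀ T : B →L[ℝ] B, ‖T‖ ≤ C → ∀ k, ‖T (w k)‖ ≤ C * ε := fun T hT k ↦
    (T.le_opNorm _).trans (mul_le_mul hT (hw k) (norm_nonneg _) hC.le)
  have decay : ∀ a n, a ≤ C * ε → C * lam ^ n * a ≤ C * (C * ε) * lam ^ n := by
    intro a n ha
    have : 0 ≤ C * lam ^ n := mul_nonneg hC.le (pow_nonneg hlam.1.le n)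
    nlinarith [mul_le_mul_of_nonneg_left ha this]
  obtain ⟨s, hsb, hse⟩ := exists_bounded_solution_of_orbitDeriv_decay (f := f) (Df := Df) hz hlam
    (c := fun k ↦ P (z k) (w k)) (K := C * (C * ε)) fun k n ↦
      (hs (z k) n _ ⟨_, rfl⟩).trans (decay _ n (bound _ (hP _) k))
  have hz' : ∀ k : ℤ, z (-(k + 1)) = fInv (z (-k)) := by
    intro k
    have := hz (-(k + 1))
    rw [show -(k + 1) + 1 = -k by ring] at this
    rw [this, hf.1]
  obtain ⟨u, hub, hue⟩ := exists_bounded_solution_of_orbitDeriv_decay (f := fInv) (Df := DfInv)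
    (z := fun k ↦ z (-k)) hz' hlam (c := fun k ↦ Q (z (-k)) (w (-k))) (K := C * (C * ε))
    fun k n ↦ (hu (z (-k)) n _ ⟨_, rfl⟩).trans (decay _ n (bound _ (hQ _) (-k)))
  have hQu : ∀ k, Q (z k) (w k) - u (-k) = -DfInv (f (z k)) (u (-(k + 1))) := by
    intro k
    have := hue (-(k + 1))
    rw [show -(k + 1) + 1 = -k by ring] at this
    simp only [neg_neg] at this
    rw [this, hz k]
    abel
  refine ⟨fun k ↦ s k + (Q (z k) (w k) - u (-k)), fun k ↦ ?_, fun k ↦ ?_⟩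
  · calc ‖s k + (Q (z k) (w k) - u (-k))‖
        ≤ ‖s k‖ + (‖Q (z k) (w k)‖ + ‖u (-k)‖) :=
          (norm_add_le _ _).trans (by gcongr; exact norm_sub_le _ _)
      _ ≤ C * (C * ε) * (1 - lam)⁻¹ + (C * ε + C * (C * ε) * (1 - lam)⁻¹) :=
          add_le_add (hsb k) (add_le_add (bound _ (hQ _) k) (hub _))
      _ = _ := by ring
  · have hw' : P (z (k + 1)) (w (k + 1)) + Q (z (k + 1)) (w (k + 1)) = w (k + 1) :=
      DFunLike.congr_fun (hPQ (z (k + 1))) (w (k + 1))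
    have h₃ : Df (z k) (Q (z k) (w k) - u (-k)) = -u (-(k + 1)) := by
      rw [hQu, map_neg, hf.comp_deriv_inv]
    simp only [map_add, h₃, hse k]
    rw [← add_right_inj (Df (z k) (s k) - u (-(k + 1)))] at hw'
    convert hw' using 1 <;> abel

/-- The bi-infinite orbit of a bijection through `p` at time `m`. -/
theorem exists_orbit_through {B : Type*}
    {f fInv : B → B} (hl : Function.LeftInverse fInv f)
    (hr : Function.RightInverse fInv f) (m : ℤ) (p : B) :
    ∃ z : ℤ → B, z m = p ∧ ∀ k, z (k + 1) = f (z k) := by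
  let e : Equiv.Perm B := ⟨f, fInv, hl, hr⟩
  refine ⟨fun k ↦ (e ^ (k - m)) p, by simp, fun k ↦ ?_⟩
  change (e ^ (k + 1 - m)) p = e ((e ^ (k - m)) p)
  rw [show k + 1 - m = 1 + (k - m) by ring, zpow_add, zpow_one]
  rfl

theorem norm_orbit_sub_pseudotrajectory_le {B : Type*} [NormedAddCommGroup B]
    {f : B → B} {R ε : ℝ} (hR : 0 ≤ R)
    (hlip : ∀ a b, ‖f a - f b‖ ≤ R * ‖a - b‖) {x z : ℤ → B}
    (hx : ∀ k, ‖x (k + 1) - f (x k)‖ ≤ ε) (hz : ∀ k, z (k + 1) = f (z k)) {m : ℤ}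
    (hm : z m = x m) (n : ℕ) : ‖z (m + n) - x (m + n)‖ ≤ (∑ j ∈ Finset.range n, R ^ j) * ε := by
  induction n with
  | zero => simp [hm]
  | succ n ih =>
    have e : m + ((n + 1 : ℕ) : ℤ) = m + n + 1 := by push_cast; ring
    rw [e, hz, geom_sum_succ]
    calc ‖f (z (m + n)) - x (m + n + 1)‖
        = ‖(f (z (m + n)) - f (x (m + n))) - (x (m + n + 1) - f (x (m + n)))‖ := by
          congr 1; abel
      _ ≤ R * ((∑ j ∈ Finset.range n, R ^ j) * ε) + ε :=
          (norm_sub_le _ _).trans (add_le_add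
            ((hlip _ _).trans (mul_le_mul_of_nonneg_left ih hR)) (hx _))
      _ = _ := by ring

/-- Gluing of approximate solutions of a linear equation which are defined on overlapping blocks
of length `2 * N`. -/
theorem exists_glued_approx_solution {B : Type*} [NormedAddCommGroup B] [NormedSpace ℝ B]
    {A : ℤ → B →L[ℝ] B} {R b η : ℝ} (hR : 0 ≤ R)
    (hA : ∀ k, ‖A k‖ ≤ R) {w : ℤ → B} {N : ℕ} (hN : 0 < N) {a : ℤ → ℤ → B}
    (hab : ∀ i k, ‖a i k‖ ≤ b)
    (ha : ∀ i k : ℤ, (i - 1) * N ≤ k → k < (i + 1) * N →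
      ‖a i (k + 1) - A k (a i k) - w (k + 1)‖ ≤ η) :
    ∃ v : ℤ → B, (∀ k, ‖v k‖ ≤ b) ∧
      ∀ k, ‖v (k + 1) - A k (v k) - w (k + 1)‖ ≤ η + 2 * R * b / N := by
  have hN' : (0 : ℝ) < N := by exact_mod_cast hN
  have hNz : (0 : ℤ) < N := by exact_mod_cast hN
  let g : ℤ → ℝ → ℤ → B := fun i t k ↦ (1 - t) • a i k + t • a (i + 1) k
  let τ : ℤ → ℝ := fun k ↦ ((k % N : ℤ) : ℝ) / N
  have hτ0 : ∀ k, 0 ≤ τ k := fun k ↦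
    div_nonneg (by exact_mod_cast Int.emod_nonneg k hNz.ne') hN'.le
  have hτ1 : ∀ k, τ k + 1 / N ≤ 1 := by
    intro k
    have : ((k % N : ℤ) : ℝ) + 1 ≤ N := by exact_mod_cast Int.emod_lt_of_pos k hNz
    rw [← add_div, div_le_one hN']
    exact this
  have hinv : (0 : ℝ) < 1 / N := by positivity
  have convex : ∀ (t c : ℝ) (p q : B), 0 ≤ t → t ≤ 1 → ‖p‖ ≤ c → ‖q‖ ≤ c →
      ‖(1 - t) • p + t • q‖ ≤ c := by
    intro t c p q h0 h1 hp hq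
    have := (convex_closedBall (0 : B) c) (x := p) (by simpa using hp) (y := q) (by simpa using hq)
      (sub_nonneg.2 h1) h0 (by ring)
    simpa using this
  refine ⟨fun k ↦ g (k / N) (τ k) k, fun k ↦ convex _ _ _ _ (hτ0 k)
    (by linarith [hτ1 k]) (hab _ _) (hab _ _), fun k ↦ ?_⟩
  have hnext : g ((k + 1) / N) (τ (k + 1)) (k + 1) = g (k / N) (τ k + 1 / N) (k + 1) := by
    have hk := Int.emod_add_mul_ediv k N
    have hk0 := Int.emod_nonneg k hNz.ne'
    have hk1 := Int.emod_lt_of_pos k hNz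
    rcases (show k % N + 1 < N ∨ k % N + 1 = N by omega) with h | h
    · have hq : (k + 1) / (N : ℤ) = k / N ∧ (k + 1) % (N : ℤ) = k % N + 1 :=
        (Int.ediv_emod_unique hNz).2 ⟨by linarith, by omega, h⟩
      simp only [τ, hq.1, hq.2]
      push_cast
      rw [add_div]
    · have hq : (k + 1) / (N : ℤ) = k / N + 1 ∧ (k + 1) % (N : ℤ) = 0 :=
        (Int.ediv_emod_unique hNz).2 ⟨by linarith, le_rfl, hNz⟩
      have h1 : τ k + 1 / N = 1 := by
        rw [← add_div, div_eq_one_iff_eq hN'.ne']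
        exact_mod_cast h
      rw [h1, hq.1]
      simp [g, τ, hq.2]
  have hlo : (k / N) * N ≤ k := Int.ediv_mul_le k hNz.ne'
  have hhi : k < (k / N + 1) * N := Int.lt_ediv_add_one_mul_self k hNz
  have e₁ := ha (k / N) k (by linarith) hhi
  have e₂ := ha (k / N + 1) k (by linarith) (by linarith)
  change ‖g ((k + 1) / N) (τ (k + 1)) (k + 1) - A k (g (k / N) (τ k) k) - w (k + 1)‖ ≤ _
  rw [hnext]
  set i := k / (N : ℤ)
  set t := τ k + 1 / N with ht
  have hdiff : ‖(1 / N : ℝ) • A k (a (i + 1) k - a i k)‖ ≤ 2 * R * b / N := by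
    have h1 : ‖a (i + 1) k - a i k‖ ≤ b + b :=
      (norm_sub_le _ _).trans (add_le_add (hab _ _) (hab _ _))
    have h2 : ‖A k (a (i + 1) k - a i k)‖ ≤ R * (b + b) :=
      ((A k).le_opNorm _).trans (mul_le_mul (hA k) h1 (norm_nonneg _) hR)
    rw [norm_smul, Real.norm_of_nonneg hinv.le]
    calc 1 / (N : ℝ) * ‖A k (a (i + 1) k - a i k)‖ ≤ 1 / N * (R * (b + b)) := by gcongr
      _ = _ := by ring
  have key : g i t (k + 1) - A k (g i (τ k) k) - w (k + 1) =
      ((1 - t) • (a i (k + 1) - A k (a i k) - w (k + 1)) +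
        t • (a (i + 1) (k + 1) - A k (a (i + 1) k) - w (k + 1))) +
      (1 / N : ℝ) • A k (a (i + 1) k - a i k) := by
    simp only [g, ht, map_add, map_sub, map_smul]
    module
  rw [key]
  exact (norm_add_le _ _).trans (add_le_add
    (convex _ _ _ _ (by linarith [hτ0 k]) (hτ1 k) e₁ e₂) hdiff)

/-- One Newton-type step: a pseudotrajectory can be moved by a distance proportional to its error
so that the error is halved. -/
theorem exists_pseudotrajectory_half_error {f fInv : B → B} {Df DfInv : B → B →L[ℝ] B} {R : ℝ}
    {r : ℝ → ℝ} (hf : IsC1Diffeo f fInv Df DfInv) (hreg : C1Reg f Df DfInv R r)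
    {C lam : ℝ} (hC : 0 < C) (hlam : lam ∈ Ioo (0 : ℝ) 1)
    {P Q : B → B →L[ℝ] B} (hCL : IsGenCL f fInv Df DfInv C lam P Q) :
    ∃ L d₀ : ℝ, 0 < L ∧ 0 < d₀ ∧ ∀ ε : ℝ, 0 < ε → ε < d₀ → ∀ x : ℤ → B,
      (∀ k, ‖x (k + 1) - f (x k)‖ ≤ ε) →
      ∃ x' : ℤ → B, (∀ k, ‖x' k - x k‖ ≤ L * ε) ∧
        ∀ k, ‖x' (k + 1) - f (x' k)‖ ≤ ε / 2 := by
  obtain ⟨hR, hmono, hr0, hrlim, htaylor, hDf, -, hcont⟩ := hreg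
  have hlip : ∀ a b, ‖f a - f b‖ ≤ R * ‖a - b‖ := fun a b ↦
    convex_univ.norm_image_sub_le_of_norm_hasFDerivWithin_le
      (fun y _ ↦ (hf.2.2.1 y).hasFDerivWithinAt) (fun y _ ↦ hDf y) (mem_univ b) (mem_univ a)
  set L : ℝ := 2 * C ^ 2 * (1 - lam)⁻¹ + C
  have hL : 0 < L := by
    have : 0 < (1 - lam)⁻¹ := inv_pos.2 (sub_pos.2 hlam.2)
    positivity
  obtain ⟨N, hN⟩ := exists_nat_gt (16 * R * L)
  have hN0 : (0 : ℝ) < N := lt_trans (by positivity) hN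
  obtain ⟨ρ, hρ, hrρ⟩ : ∃ ρ : ℝ, 0 < ρ ∧ ∀ s, 0 ≤ s → s ≤ ρ → r s ≤ 1 / (8 * L) := by
    have h1 : ∀ᶠ s in nhdsWithin (0 : ℝ) (Ioi 0), r s < 1 / (8 * L) :=
      hrlim.eventually (gt_mem_nhds (by positivity))
    obtain ⟨ρ, hρ1, hρ2⟩ := (h1.and self_mem_nhdsWithin).exists
    have hρ0 : (0 : ℝ) < ρ := hρ2
    exact ⟨ρ, hρ0, fun s hs hsρ ↦ (hmono hs hρ0.le hsρ).trans hρ1.le⟩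
  set K : ℝ := ∑ j ∈ Finset.range (2 * N), R ^ j
  have hK : 0 ≤ K := Finset.sum_nonneg fun j _ ↦ pow_nonneg hR.le j
  refine ⟨L, ρ / (K + L), hL, by positivity, fun ε hε hεd x hx ↦ ?_⟩
  have hsmall : K * ε ≤ ρ ∧ L * ε ≤ ρ := by
    rw [lt_div_iff₀ (by positivity)] at hεd
    constructor <;> nlinarith [mul_nonneg hK hε.le, mul_pos hL hε]
  choose z hz₀ hz using fun i : ℤ ↦ exists_orbit_through hf.1 hf.2.1 ((i - 1) * N)
    (x ((i - 1) * N))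
  let w : ℤ → B := fun k ↦ f (x (k - 1)) - x k
  have hw : ∀ k, ‖w k‖ ≤ ε := by
    intro k
    have := hx (k - 1)
    rwa [sub_add_cancel, norm_sub_rev] at this
  choose a hab hae using fun i ↦ hCL.exists_bounded_solution hf hC hlam (hz i) hw
  obtain ⟨v, hvb, hve⟩ := exists_glued_approx_solution (A := fun k ↦ Df (x k)) (w := w)
    (N := N) (η := ε / 8) hR.le (fun k ↦ hDf (x k)) (by exact_mod_cast hN0) hab (by
      intro i k hk₁ hk₂
      obtain ⟨n, hn⟩ := Int.le.dest hk₁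
      have hn2 : n ≤ 2 * N := by zify; linarith
      have hzx : ‖z i k - x k‖ ≤ K * ε := by
        rw [← hn]
        refine (norm_orbit_sub_pseudotrajectory_le hR.le hlip hx (hz i) (hz₀ i) n).trans ?_
        gcongr
        exact Finset.sum_le_sum_of_subset_of_nonneg (Finset.range_mono hn2)
          fun j _ _ ↦ pow_nonneg hR.le j
      have hD : ‖Df (z i k) - Df (x k)‖ ≤ 1 / (8 * L) := by
        have := hcont (x k) (z i k - x k)
        rw [add_sub_cancel] at this
        exact this.trans (hrρ _ (norm_nonneg _) (hzx.trans hsmall.1))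
      rw [hae, show Df (z i k) (a i k) + w (k + 1) - Df (x k) (a i k) - w (k + 1) =
        (Df (z i k) - Df (x k)) (a i k) by rw [sub_apply]; abel]
      calc _ ≤ 1 / (8 * L) * (L * ε) := ((Df (z i k) - Df (x k)).le_opNorm _).trans
            (mul_le_mul hD (hab i k) (norm_nonneg _) (by positivity))
        _ = ε / 8 := by field_simp)
  refine ⟨fun k ↦ x k + v k, fun k ↦ by simpa using hvb k, fun k ↦ ?_⟩
  have hrem : ‖f (x k + v k) - f (x k) - Df (x k) (v k)‖ ≤ ε / 8 := by
    calc _ ≤ (L * ε) * (1 / (8 * L)) := (htaylor _ _).trans (mul_le_mul (hvb k)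
          (hrρ _ (norm_nonneg _) ((hvb k).trans hsmall.2)) (hr0 _ (norm_nonneg _)) (by positivity))
      _ = ε / 8 := by field_simp
  have hglue : 2 * R * (L * ε) / N ≤ ε / 8 := by
    rw [div_le_iff₀ hN0]
    nlinarith
  have hsplit : x (k + 1) + v (k + 1) - f (x k + v k) =
      (v (k + 1) - Df (x k) (v k) - w (k + 1)) -
        (f (x k + v k) - f (x k) - Df (x k) (v k)) := by
    simp only [w, add_sub_cancel_right]
    abel
  rw [hsplit]
  refine (norm_sub_le _ _).trans ?_
  linarith [hve k]

/-- If errors of pseudotrajectories can be halved at proportional cost, then pseudotrajectories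
are shadowed by exact trajectories. -/
theorem exists_trajectory_of_half_error {B : Type*} [NormedAddCommGroup B] [CompleteSpace B]
    {f : B → B} (hfc : Continuous f) {L d₀ : ℝ}
    (hstep : ∀ ε : ℝ, 0 < ε → ε < d₀ → ∀ x : ℤ → B, (∀ k, ‖x (k + 1) - f (x k)‖ ≤ ε) →
      ∃ x' : ℤ → B, (∀ k, ‖x' k - x k‖ ≤ L * ε) ∧ ∀ k, ‖x' (k + 1) - f (x' k)‖ ≤ ε / 2)
    {d : ℝ} (hd : 0 < d) (hdd : d < d₀) {y : ℤ → B} (hy : ∀ k, ‖y (k + 1) - f (y k)‖ ≤ d) :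
    ∃ x : ℤ → B, (∀ k, x (k + 1) = f (x k)) ∧ ∀ k, ‖x k - y k‖ ≤ 2 * L * d := by
  have hstep' : ∀ (ε : ℝ) (x : ℤ → B), ∃ x' : ℤ → B, 0 < ε → ε < d₀ →
      (∀ k, ‖x (k + 1) - f (x k)‖ ≤ ε) →
      (∀ k, ‖x' k - x k‖ ≤ L * ε) ∧ ∀ k, ‖x' (k + 1) - f (x' k)‖ ≤ ε / 2 := by
    intro ε x
    by_cases h : 0 < ε ∧ ε < d₀ ∧ ∀ k, ‖x (k + 1) - f (x k)‖ ≤ ε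
    · obtain ⟨x', hx'⟩ := hstep ε h.1 h.2.1 x h.2.2
      exact ⟨x', fun _ _ _ ↦ hx'⟩
    · exact ⟨x, fun h₁ h₂ h₃ ↦ absurd ⟨h₁, h₂, h₃⟩ h⟩
  choose g hg using hstep'
  let X : ℕ → ℤ → B := fun n ↦ Nat.rec y (fun m x ↦ g (d / 2 ^ m) x) n
  have hpos : ∀ n : ℕ, 0 < d / 2 ^ n := fun n ↦ by positivity
  have hlt : ∀ n : ℕ, d / 2 ^ n < d₀ := fun n ↦
    (div_le_self hd.le (one_le_pow₀ one_le_two)).trans_lt hdd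
  have herr : ∀ n k, ‖X n (k + 1) - f (X n k)‖ ≤ d / 2 ^ n := by
    intro n
    induction n with
    | zero => simpa [X] using hy
    | succ n ih =>
      intro k
      have := (hg _ _ (hpos n) (hlt n) ih).2 k
      rwa [div_div, ← pow_succ] at this
  have hdist : ∀ k n, dist (X n k) (X (n + 1) k) ≤ 2 * L * d / 2 / 2 ^ n := by
    intro k n
    rw [dist_comm, dist_eq_norm]
    refine ((hg _ _ (hpos n) (hlt n) (herr n)).1 k).trans_eq ?_
    ring
  choose x hx using fun k ↦ cauchySeq_tendsto_of_complete
    (cauchySeq_of_le_geometric_two (hdist k))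
  refine ⟨x, fun k ↦ ?_, fun k ↦ ?_⟩
  · have h₁ : Tendsto (fun n ↦ ‖X n (k + 1) - f (X n k)‖) atTop
        (nhds ‖x (k + 1) - f (x k)‖) :=
      ((hx (k + 1)).sub ((hfc.tendsto _).comp (hx k))).norm
    have h₂ : Tendsto (fun n : ℕ ↦ d / 2 ^ n) atTop (nhds 0) :=
      tendsto_const_nhds.div_atTop (tendsto_pow_atTop_atTop_of_one_lt one_lt_two)
    have h₃ := le_of_tendsto_of_tendsto' h₁ h₂ fun n ↦ herr n k
    exact sub_eq_zero.1 (norm_le_zero_iff.1 h₃)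
  · rw [← dist_eq_norm, dist_comm]
    exact dist_le_of_le_geometric_two_of_tendsto₀ (hdist k) (hx k)

/-- Lipschitz shadowing: a `C¹` diffeomorphism of a *reflexive* Banach
space satisfying the `C¹` regularity conditions and a generalized `(C, λ)`-structure has
the Lipschitz shadowing property. -/
theorem statement10
    {B : Type*} [NormedAddCommGroup B] [NormedSpace ℝ B] [CompleteSpace B]
    (hrefl : Function.Surjective (NormedSpace.inclusionInDoubleDual ℝ B))
    (f fInv : B → B) (Df DfInv : B → B →L[ℝ] B) (R : ℝ) (r : ℝ → ℝ)
    (hf : IsC1Diffeo f fInv Df DfInv) (hreg : C1Reg f Df DfInv R r)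
    (C lam : ℝ) (hC : 0 < C) (hlam : lam ∈ Set.Ioo (0 : ℝ) 1)
    (P Q : B → B →L[ℝ] B) (hCL : IsGenCL f fInv Df DfInv C lam P Q) :
    ∃ M d₀ : ℝ, 0 < M ∧ 0 < d₀ ∧
      ∀ d : ℝ, 0 < d → d < d₀ → ∀ y : ℤ → B,
        (∀ k, ‖y (k + 1) - f (y k)‖ ≤ d) →
        ∃ x : ℤ → B, (∀ k, x (k + 1) = f (x k)) ∧ ∀ k, ‖x k - y k‖ ≤ M * d := by
  obtain ⟨L, d₀, hL, hd₀, hstep⟩ := exists_pseudotrajectory_half_error hf hreg hC hlam hCL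
  have hfc : Continuous f := continuous_iff_continuousAt.2 fun x ↦ (hf.2.2.1 x).continuousAt
  exact ⟨2 * L, d₀, by positivity, hd₀, fun d hd hdd y hy ↦
    exists_trajectory_of_half_error hfc hstep hd hdd hy⟩

end
end

section
/- Let B be a reflexive Banach space and f : B → B a C¹ diffeomorphism satisfying the C¹ regularity conditions and a generalized (C,λ)-structure. Then f satisfies the Lipschitz periodic shadowing property: there exist M, d₀ > 0 such that for any d < d₀, any N ≥ 1, and any N-periodic d-pseudotrajectory {y_k}_{k∈ℤ} of f (y_{k+N} = y_k for all k), there exists an N-periodic exact trajectory {x_k}_{k∈ℤ} (x_{k+1} = f(x_k), x_{k+N} = x_k) with |x_k − y_k| ≤ Md for all k ∈ ℤ. -/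
open Set Filter

noncomputable section

variable {B : Type*} [NormedAddCommGroup B] [NormedSpace ℝ B] [CompleteSpace B]

section WindowSolution

variable {E : Type*} [NormedAddCommGroup E] [NormedSpace ℝ E]

lemma orbitDeriv_succ_eq_comp (f : E → E) (Df : E → E →L[ℝ] E) (n : ℕ) (x : E) :
    orbitDeriv f Df (n + 1) x = Df (f^[n] x) ∘L orbitDeriv f Df n x := by
  induction n generalizing x with
  | zero => ext v; simp [orbitDeriv]
  | succ n ih =>
    rw [orbitDeriv, ih, orbitDeriv, Function.iterate_succ_apply, ContinuousLinearMap.comp_assoc]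

lemma IsC1Diffeo.deriv_apply_deriv_inv {f fInv : E → E} {Df DfInv : E → E →L[ℝ] E}
    (hf : IsC1Diffeo f fInv Df DfInv) (x v : E) : Df (fInv x) (DfInv x v) = v := by
  obtain ⟨-, hr, hD, hDI⟩ := hf
  have h : HasFDerivAt (f ∘ fInv) (Df (fInv x) ∘L DfInv x) x := (hD _).comp x (hDI x)
  rw [hr.comp_eq_id] at h
  exact DFunLike.congr_fun (h.unique (hasFDerivAt_id x)) v

lemma Function.LeftInverse.iterate_apply_iterate {α : Type*} {f g : α → α}
    (h : Function.LeftInverse g f) {m n : ℕ} (hmn : m ≤ n) (x : α) :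
    g^[m] (f^[n] x) = f^[n - m] x := by
  obtain ⟨k, rfl⟩ := Nat.exists_eq_add_of_le hmn
  rw [Function.iterate_add_apply, h.iterate m, Nat.add_sub_cancel_left]

lemma sum_range_pow_le_inv_one_sub {a : ℝ} (ha : a ∈ Set.Ioo (0 : ℝ) 1) (n : ℕ) :
    ∑ i ∈ Finset.range n, a ^ i ≤ (1 - a)⁻¹ := by
  rw [← tsum_geometric_of_lt_one ha.1.le ha.2]
  exact (summable_geometric_of_lt_one ha.1.le ha.2).sum_le_tsum _
    fun i _ => pow_nonneg ha.1.le i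

/-- Along the orbit of `x`, the solution on the time window `0, …, T` of the inhomogeneous
linearised equation with forcing `w` which propagates the stable components of `w` forwards and
the unstable ones backwards. -/
def windowSolution (f fInv : E → E) (Df DfInv P Q : E → E →L[ℝ] E) (T : ℕ)
    (x : E) (w : ℕ → E) (j : ℕ) : E :=
  (∑ i ∈ Finset.range (j + 1), orbitDeriv f Df (j - i) (f^[i] x) (P (f^[i] x) (w i))) -
    ∑ i ∈ Finset.Ico (j + 1) (T + 1),
      orbitDeriv fInv DfInv (i - j) (f^[i] x) (Q (f^[i] x) (w i))

lemma windowSolution_sub (f fInv : E → E) (Df DfInv P Q : E → E →L[ℝ] E) (T : ℕ)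
    (x : E) (w w' : ℕ → E) (j : ℕ) :
    windowSolution f fInv Df DfInv P Q T x (w - w') j =
      windowSolution f fInv Df DfInv P Q T x w j -
        windowSolution f fInv Df DfInv P Q T x w' j := by
  simp only [windowSolution, Pi.sub_apply, map_sub, Finset.sum_sub_distrib]
  abel

variable {f fInv : E → E} {Df DfInv P Q : E → E →L[ℝ] E}

lemma windowSolution_succ (hf : IsC1Diffeo f fInv Df DfInv)
    (hPQ : ∀ x, P x + Q x = ContinuousLinearMap.id ℝ E) {T j : ℕ} (hj : j < T)
    (x : E) (w : ℕ → E) :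
    windowSolution f fInv Df DfInv P Q T x w (j + 1) =
      Df (f^[j] x) (windowSolution f fInv Df DfInv P Q T x w j) + w (j + 1) := by
  have hw : P (f^[j + 1] x) (w (j + 1)) + Q (f^[j + 1] x) (w (j + 1)) = w (j + 1) :=
    DFunLike.congr_fun (hPQ (f^[j + 1] x)) (w (j + 1))
  have hs : ∀ i ∈ Finset.range (j + 1),
      orbitDeriv f Df (j + 1 - i) (f^[i] x) (P (f^[i] x) (w i)) =
        Df (f^[j] x) (orbitDeriv f Df (j - i) (f^[i] x) (P (f^[i] x) (w i))) := by
    intro i hi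
    have hij : i ≤ j := Nat.lt_succ_iff.1 (Finset.mem_range.1 hi)
    rw [Nat.succ_sub hij, orbitDeriv_succ_eq_comp, ContinuousLinearMap.comp_apply,
      ← Function.iterate_add_apply, Nat.sub_add_cancel hij]
  have hu : ∀ i, j + 1 ≤ i → ∀ v,
      Df (f^[j] x) (orbitDeriv fInv DfInv (i - j) (f^[i] x) v) =
        orbitDeriv fInv DfInv (i - (j + 1)) (f^[i] x) v := by
    intro i hi v
    obtain ⟨m, rfl⟩ := Nat.exists_eq_add_of_le hi
    have h1 : j + 1 + m - j = m + 1 := by omega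
    have h2 : j + 1 + m - (j + 1) = m := by omega
    have h3 : fInv (fInv^[m] (f^[j + 1 + m] x)) = f^[j] x := by
      rw [← Function.iterate_succ_apply' fInv, hf.1.iterate_apply_iterate (by omega)]
      congr 2
      omega
    rw [h1, h2, orbitDeriv_succ_eq_comp, ContinuousLinearMap.comp_apply, ← h3,
      hf.deriv_apply_deriv_inv]
  rw [windowSolution, windowSolution, map_sub, map_sum, map_sum, Finset.sum_range_succ,
    Finset.sum_congr rfl hs,
    Finset.sum_congr rfl fun i hi => hu i (Finset.mem_Ico.1 hi).1 _,
    Finset.sum_eq_sum_Ico_succ_bot (show j + 1 < T + 1 by omega)]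
  simp only [Nat.sub_self, orbitDeriv, ContinuousLinearMap.id_apply]
  rw [eq_sub_of_add_eq hw]
  abel

lemma norm_windowSolution_le {C lam : ℝ} (hC : 0 < C) (hlam : lam ∈ Set.Ioo (0 : ℝ) 1)
    (hCL : IsGenCL f fInv Df DfInv C lam P Q) (T : ℕ) (x : E) {w : ℕ → E} {M : ℝ}
    (hw : ∀ i, ‖w i‖ ≤ M) (j : ℕ) :
    ‖windowSolution f fInv Df DfInv P Q T x w j‖ ≤ 2 * C ^ 2 * (1 - lam)⁻¹ * M := by
  obtain ⟨-, hP, hQ, -, -, hs, hu⟩ := hCL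
  have hM : 0 ≤ M := (norm_nonneg _).trans (hw 0)
  have hl := hlam.1
  have hS : ∀ i ∈ Finset.range (j + 1),
      ‖orbitDeriv f Df (j - i) (f^[i] x) (P (f^[i] x) (w i))‖ ≤ C ^ 2 * M * lam ^ (j - i) := by
    intro i _
    calc _ ≤ C * lam ^ (j - i) * ‖P (f^[i] x) (w i)‖ := hs _ _ _ (Set.mem_range_self _)
      _ ≤ C * lam ^ (j - i) * (C * M) := by
        gcongr
        exact (P (f^[i] x)).le_of_opNorm_le_of_le (hP _) (hw i)
      _ = _ := by ring
  have hU : ∀ i ∈ Finset.Ico (j + 1) (T + 1),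
      ‖orbitDeriv fInv DfInv (i - j) (f^[i] x) (Q (f^[i] x) (w i))‖ ≤
        C ^ 2 * M * lam ^ (i - (j + 1)) := by
    intro i _
    calc _ ≤ C * lam ^ (i - j) * ‖Q (f^[i] x) (w i)‖ := hu _ _ _ (Set.mem_range_self _)
      _ ≤ C * lam ^ (i - (j + 1)) * (C * M) := by
        gcongr ?_ * ?_ * ?_
        · exact pow_le_pow_of_le_one hl.le hlam.2.le (by omega)
        · exact (Q (f^[i] x)).le_of_opNorm_le_of_le (hQ _) (hw i)
      _ = _ := by ring
  have e1 : ∑ i ∈ Finset.range (j + 1), lam ^ (j - i) ≤ (1 - lam)⁻¹ := by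
    have := Finset.sum_range_reflect (fun i => lam ^ i) (j + 1)
    simp only [Nat.add_sub_cancel] at this
    rw [this]
    exact sum_range_pow_le_inv_one_sub hlam _
  have e2 : ∑ i ∈ Finset.Ico (j + 1) (T + 1), lam ^ (i - (j + 1)) ≤ (1 - lam)⁻¹ := by
    rw [Finset.sum_Ico_eq_sum_range]
    simp only [Nat.add_sub_cancel_left]
    exact sum_range_pow_le_inv_one_sub hlam _
  calc _ ≤ _ := norm_sub_le _ _
    _ ≤ C ^ 2 * M * (1 - lam)⁻¹ + C ^ 2 * M * (1 - lam)⁻¹ := by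
      refine add_le_add ((norm_sum_le_of_le _ hS).trans ?_) ((norm_sum_le_of_le _ hU).trans ?_)
      · rw [← Finset.mul_sum]; gcongr
      · rw [← Finset.mul_sum]; gcongr
    _ = _ := by ring

end WindowSolution

section WindowAverage

variable {E : Type*} [NormedAddCommGroup E] [NormedSpace ℝ E]

/-- The average, over the `T` windows containing the time `k`, of the window solutions
`V (y m)` started at the times `m = k - j`. -/
def windowAverage (V : E → (ℕ → E) → ℕ → E) (T : ℕ) (y w : ℤ → E) (k : ℤ) : E :=
  (T : ℝ)⁻¹ • ∑ j ∈ Finset.range T, V (y (k - j)) (fun i => w (k - j + i)) j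

variable {V : E → (ℕ → E) → ℕ → E}

lemma windowAverage_sub (hV : ∀ x w w' j, V x (w - w') j = V x w j - V x w' j) (T : ℕ)
    (y w w' : ℤ → E) (k : ℤ) :
    windowAverage V T y (w - w') k = windowAverage V T y w k - windowAverage V T y w' k := by
  rw [windowAverage, windowAverage, windowAverage, ← smul_sub, ← Finset.sum_sub_distrib]
  simp only [← hV]
  rfl

lemma windowAverage_periodic {T : ℕ} {N : ℤ} {y w : ℤ → E} (hy : ∀ k, y (k + N) = y k)
    (hw : ∀ k, w (k + N) = w k) (k : ℤ) :
    windowAverage V T y w (k + N) = windowAverage V T y w k := by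
  have h1 : ∀ j : ℤ, y (k + N - j) = y (k - j) := fun j => by
    rw [← hy (k - j)]; congr 1; ring
  have h2 : ∀ j i : ℤ, w (k + N - j + i) = w (k - j + i) := fun j i => by
    rw [← hw (k - j + i)]; congr 1; ring
  simp only [windowAverage, h1, h2]

lemma norm_windowAverage_le {L : ℝ}
    (hbd : ∀ x w M, (∀ i, ‖w i‖ ≤ M) → ∀ j, ‖V x w j‖ ≤ L * M)
    {T : ℕ} (hT : 0 < T) (y : ℤ → E) {w : ℤ → E} {M : ℝ}
    (hw : ∀ k, ‖w k‖ ≤ M) (k : ℤ) : ‖windowAverage V T y w k‖ ≤ L * M := by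
  have hT' : (0 : ℝ) < T := by exact_mod_cast hT
  rw [windowAverage, norm_smul, norm_inv, Real.norm_natCast, inv_mul_le_iff₀ hT']
  refine (norm_sum_le_of_le _ fun j _ => hbd _ _ M (fun i => hw _) j).trans ?_
  simp

lemma norm_windowAverage_residual_le {L : ℝ}
    (hbd : ∀ x w M, (∀ i, ‖w i‖ ≤ M) → ∀ j, ‖V x w j‖ ≤ L * M)
    {f : E → E} {D : E → E →L[ℝ] E} {T : ℕ} (hT : 0 < T)
    (hrec : ∀ x w j, j < T → V x w (j + 1) = D (f^[j] x) (V x w j) + w (j + 1))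
    {y : ℤ → E} {ε : ℝ}
    (hD : ∀ (k : ℤ) (j : ℕ), j < T → ‖D (f^[j] (y (k - j))) - D (y k)‖ ≤ ε)
    {w : ℤ → E} {M : ℝ} (hw : ∀ k, ‖w k‖ ≤ M) (k : ℤ) :
    ‖windowAverage V T y w (k + 1) - D (y k) (windowAverage V T y w k) - w (k + 1)‖ ≤
      (2 * L / T + ε * L) * M := by
  have hT' : (0 : ℝ) < T := by exact_mod_cast hT
  set a : ℕ → E := fun j => V (y (k + 1 - j)) (fun i => w (k + 1 - j + i)) j with ha
  set b : ℕ → E := fun j => V (y (k - j)) (fun i => w (k - j + i)) j with hb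
  have hab : ∀ j ∈ Finset.range T, a (j + 1) = D (f^[j] (y (k - j))) (b j) + w (k + 1) := by
    intro j hj
    have e : k + 1 - ((j + 1 : ℕ) : ℤ) = k - j := by push_cast; ring
    simp only [ha, hb, e]
    rw [hrec _ _ _ (Finset.mem_range.1 hj)]
    congr 2
    push_cast
    ring
  have hsum : ∑ j ∈ Finset.range T, a j + a T =
      ∑ j ∈ Finset.range T, (D (f^[j] (y (k - j))) (b j) + w (k + 1)) + a 0 := by
    rw [← Finset.sum_range_succ, Finset.sum_range_succ', Finset.sum_congr rfl hab]
  have key : windowAverage V T y w (k + 1) - D (y k) (windowAverage V T y w k) - w (k + 1) =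
      (T : ℝ)⁻¹ • ((a 0 - a T) +
        ∑ j ∈ Finset.range T, (D (f^[j] (y (k - j))) - D (y k)) (b j)) := by
    have hwk : w (k + 1) = (T : ℝ)⁻¹ • ((T : ℝ) • w (k + 1)) := by
      rw [inv_smul_smul₀ hT'.ne']
    rw [Finset.sum_add_distrib, Finset.sum_const, Finset.card_range, ← Nat.cast_smul_eq_nsmul ℝ]
      at hsum
    conv_lhs => rw [hwk]
    rw [windowAverage, windowAverage, map_smul, ← smul_sub, ← smul_sub, map_sum]
    congr 1
    simp only [sub_apply, Finset.sum_sub_distrib]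
    rw [eq_sub_of_add_eq hsum]
    abel
  have ha' : ∀ j, ‖a j‖ ≤ L * M := fun j => hbd _ _ M (fun i => hw _) j
  have hb' : ∀ j, ‖b j‖ ≤ L * M := fun j => hbd _ _ M (fun i => hw _) j
  have hs : ‖∑ j ∈ Finset.range T, (D (f^[j] (y (k - j))) - D (y k)) (b j)‖ ≤
      T * (ε * (L * M)) := by
    refine (norm_sum_le_of_le _ fun j hj => ContinuousLinearMap.le_of_opNorm_le_of_le _
      (hD k j (Finset.mem_range.1 hj)) (hb' j)).trans ?_
    simp
  rw [key, norm_smul, norm_inv, Real.norm_natCast, inv_mul_le_iff₀ hT']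
  calc _ ≤ (‖a 0‖ + ‖a T‖) + T * (ε * (L * M)) :=
        (norm_add_le _ _).trans (add_le_add (norm_sub_le _ _) hs)
    _ ≤ (L * M + L * M) + T * (ε * (L * M)) := by gcongr <;> exact ha' _
    _ = _ := by field_simp; ring

end WindowAverage

/-- A uniform contraction of bounded sequences which preserves periodicity has a periodic fixed
point. -/
lemma exists_periodic_fixedPoint {E : Type*} [NormedAddCommGroup E] [CompleteSpace E]
    {Φ : (ℤ → E) → ℤ → E} {d : ℝ} {N : ℤ} (h0 : ∀ k, ‖Φ 0 k‖ ≤ d)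
    (hΦ : ∀ w w' M, (∀ k, ‖w k‖ ≤ 4 * d) → (∀ k, ‖w' k‖ ≤ 4 * d) →
      (∀ k, ‖w k - w' k‖ ≤ M) → ∀ k, ‖Φ w k - Φ w' k‖ ≤ 3 / 4 * M)
    (hper : ∀ w, (∀ k, w (k + N) = w k) → ∀ k, Φ w (k + N) = Φ w k) :
    ∃ w : ℤ → E, (∀ k, ‖w k‖ ≤ 4 * d) ∧ (∀ k, w (k + N) = w k) ∧ ∀ k, Φ w k = w k := by
  have hd : 0 ≤ d := (norm_nonneg _).trans (h0 0)
  have h00 : ∀ k, ‖(0 : ℤ → E) k‖ ≤ 4 * d := fun k => by simpa using hd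
  set u : ℕ → ℤ → E := fun n => Φ^[n] 0 with hu
  have hsucc : ∀ n, u (n + 1) = Φ (u n) := fun n => Function.iterate_succ_apply' _ _ _
  have hbd : ∀ n k, ‖u n k‖ ≤ 4 * d := by
    intro n
    induction n with
    | zero => exact h00
    | succ n ih =>
      intro k
      have h1 := hΦ (u n) 0 (4 * d) ih h00 (fun k => by simpa using ih k) k
      have h2 := norm_le_norm_add_norm_sub' (Φ (u n) k) (Φ 0 k)
      rw [hsucc]
      linarith [h0 k]
  have hpu : ∀ n k, u n (k + N) = u n k := by
    intro n
    induction n with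
    | zero => intro k; rfl
    | succ n ih => rw [hsucc]; exact hper _ ih
  have hdiff : ∀ n k, ‖u n k - u (n + 1) k‖ ≤ d * (3 / 4) ^ n := by
    intro n
    induction n with
    | zero => intro k; simpa [hu] using h0 k
    | succ n ih =>
      intro k
      rw [hsucc (n + 1)]
      nth_rewrite 1 [hsucc n]
      refine (hΦ _ _ _ (hbd _) (hbd _) ih k).trans_eq ?_
      ring
  have hdist : ∀ k n, dist (u n k) (u (n + 1) k) ≤ d * (3 / 4) ^ n := fun k n => by
    rw [dist_eq_norm]; exact hdiff n k
  choose w hw using fun k =>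
    cauchySeq_tendsto_of_complete (cauchySeq_of_le_geometric _ _ (by norm_num) (hdist k))
  have hwbd : ∀ k, ‖w k‖ ≤ 4 * d := fun k =>
    le_of_tendsto (hw k).norm (Eventually.of_forall fun n => hbd n k)
  have hlim : ∀ n k, ‖u n k - w k‖ ≤ d * (3 / 4) ^ n / (1 - 3 / 4) := fun n k => by
    rw [← dist_eq_norm]
    exact dist_le_of_le_geometric_of_tendsto _ _ (by norm_num) (hdist k) (hw k) n
  refine ⟨w, hwbd, fun k => ?_, fun k => ?_⟩
  · refine tendsto_nhds_unique (hw (k + N)) ?_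
    simpa only [hpu] using hw k
  · refine tendsto_nhds_unique ?_ ((tendsto_add_atTop_iff_nat 1).2 (hw k))
    rw [tendsto_iff_norm_sub_tendsto_zero]
    refine squeeze_zero (fun _ => norm_nonneg _)
      (fun n => ?_) (g := fun n => 3 / 4 * (d * (3 / 4) ^ n / (1 - 3 / 4))) ?_
    · rw [hsucc]
      exact hΦ _ _ _ (hbd n) hwbd (hlim n) k
    · have := tendsto_pow_atTop_nhds_zero_of_lt_one (r := (3 / 4 : ℝ)) (by norm_num) (by norm_num)
      simpa using ((this.const_mul d).div_const (1 - 3 / 4)).const_mul (3 / 4)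

/-- Quantitative solvability of `v (k + 1) = A k (v k) + h k (v k)` in periodic sequences, when
the linear part has an approximate right inverse `S`. -/
lemma exists_periodic_solution {E : Type*} [NormedAddCommGroup E] [NormedSpace ℝ E]
    [CompleteSpace E] {S : (ℤ → E) → ℤ → E} {A : ℤ → E →L[ℝ] E} {h : ℤ → E → E}
    {N : ℤ} {L d ρ : ℝ} (hL : 0 < L) (hd : L * (4 * d) ≤ ρ)
    (hSsub : ∀ w w' k, S (w - w') k = S w k - S w' k)
    (hSper : ∀ w, (∀ k, w (k + N) = w k) → ∀ k, S w (k + N) = S w k)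
    (hSbd : ∀ w M, (∀ k, ‖w k‖ ≤ M) → ∀ k, ‖S w k‖ ≤ L * M)
    (hSres : ∀ w M, (∀ k, ‖w k‖ ≤ M) →
      ∀ k, ‖S w (k + 1) - A k (S w k) - w (k + 1)‖ ≤ 1 / 2 * M)
    (hA : ∀ k, A (k + N) = A k) (hh : ∀ k, h (k + N) = h k) (hh0 : ∀ k, ‖h k 0‖ ≤ d)
    (hhlip : ∀ k v v', ‖v‖ ≤ ρ → ‖v'‖ ≤ ρ → ‖h k v - h k v'‖ ≤ 1 / (4 * L) * ‖v - v'‖) :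
    ∃ v : ℤ → E, (∀ k, ‖v k‖ ≤ L * (4 * d)) ∧ (∀ k, v (k + N) = v k) ∧
      ∀ k, v (k + 1) = A k (v k) + h k (v k) := by
  have hS0 : ∀ k, S 0 k = 0 := fun k => by simpa using hSsub 0 0 k
  set Φ : (ℤ → E) → ℤ → E := fun w k =>
    h (k - 1) (S w (k - 1)) - (S w k - A (k - 1) (S w (k - 1)) - w k) with hΦ
  have hshift : ∀ k, k + N - 1 = k - 1 + N := fun k => by ring
  obtain ⟨w, hwbd, hwper, hwfix⟩ := exists_periodic_fixedPoint (Φ := Φ) (d := d) (N := N)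
    (fun k => by simpa [hΦ, hS0] using hh0 (k - 1))
    (fun w w' M hw hw' hM k => by
      have hM' : ∀ k, ‖(w - w') k‖ ≤ M := hM
      have e1 : ‖h (k - 1) (S w (k - 1)) - h (k - 1) (S w' (k - 1))‖ ≤ 1 / 4 * M := by
        refine (hhlip _ _ _ ((hSbd w _ hw _).trans hd) ((hSbd w' _ hw' _).trans hd)).trans ?_
        rw [← hSsub]
        calc _ ≤ 1 / (4 * L) * (L * M) := by gcongr; exact hSbd _ _ hM' _
          _ = _ := by field_simp
      have e2 := hSres _ _ hM' (k - 1)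
      rw [sub_add_cancel, hSsub, hSsub, map_sub, Pi.sub_apply] at e2
      have e3 : Φ w k - Φ w' k = (h (k - 1) (S w (k - 1)) - h (k - 1) (S w' (k - 1))) -
          (S w k - S w' k - (A (k - 1) (S w (k - 1)) - A (k - 1) (S w' (k - 1))) -
            (w k - w' k)) := by
        simp only [hΦ]; abel
      rw [e3]
      linarith [norm_sub_le (h (k - 1) (S w (k - 1)) - h (k - 1) (S w' (k - 1)))
        (S w k - S w' k - (A (k - 1) (S w (k - 1)) - A (k - 1) (S w' (k - 1))) - (w k - w' k))])
    (fun w hw k => by simp only [hΦ, hshift, hSper w hw, hA, hh, hw])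
  refine ⟨S w, hSbd w _ hwbd, hSper w hwper, fun k => ?_⟩
  have h1 := hwfix (k + 1)
  simp only [hΦ, add_sub_cancel_right] at h1
  rw [sub_sub_eq_add_sub, sub_eq_iff_eq_add, add_comm, add_right_inj] at h1
  rw [h1, add_sub_cancel]

lemma norm_iterate_sub_le_of_pseudotrajectory {E : Type*} [NormedAddCommGroup E] {f : E → E}
    {R d : ℝ} (hR : 0 ≤ R) (hf : ∀ a b, ‖f a - f b‖ ≤ R * ‖a - b‖) {y : ℤ → E}
    (hy : ∀ k, ‖y (k + 1) - f (y k)‖ ≤ d) (j : ℕ) (k : ℤ) :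
    ‖f^[j] (y k) - y (k + j)‖ ≤ (∑ i ∈ Finset.range j, R ^ i) * d := by
  induction j with
  | zero => simp
  | succ j ih =>
    have e : k + ((j + 1 : ℕ) : ℤ) = k + j + 1 := by push_cast; ring
    rw [Function.iterate_succ_apply', e, geom_sum_succ]
    calc _ ≤ ‖f (f^[j] (y k)) - f (y (k + j))‖ + ‖f (y (k + j)) - y (k + j + 1)‖ :=
          norm_sub_le_norm_sub_add_norm_sub _ _ _
      _ ≤ R * ((∑ i ∈ Finset.range j, R ^ i) * d) + d := by
        gcongr
        · exact (hf _ _).trans (by gcongr)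
        · rw [norm_sub_rev]; exact hy _
      _ = _ := by ring

/-- Lipschitz periodic shadowing: a `C¹` diffeomorphism of a reflexive
Banach space satisfying the `C¹` regularity conditions and a generalized
`(C, λ)`-structure has the Lipschitz periodic shadowing property. -/
theorem statement11
    {B : Type*} [NormedAddCommGroup B] [NormedSpace ℝ B] [CompleteSpace B]
    (hrefl : Function.Surjective (NormedSpace.inclusionInDoubleDual ℝ B))
    (f fInv : B → B) (Df DfInv : B → B →L[ℝ] B) (R : ℝ) (r : ℝ → ℝ)
    (hf : IsC1Diffeo f fInv Df DfInv) (hreg : C1Reg f Df DfInv R r)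
    (C lam : ℝ) (hC : 0 < C) (hlam : lam ∈ Set.Ioo (0 : ℝ) 1)
    (P Q : B → B →L[ℝ] B) (hCL : IsGenCL f fInv Df DfInv C lam P Q) :
    ∃ M d₀ : ℝ, 0 < M ∧ 0 < d₀ ∧
      ∀ d : ℝ, 0 < d → d < d₀ → ∀ N : ℤ, 1 ≤ N → ∀ y : ℤ → B,
        (∀ k, y (k + N) = y k) →
        (∀ k, ‖y (k + 1) - f (y k)‖ ≤ d) →
        ∃ x : ℤ → B, (∀ k, x (k + 1) = f (x k)) ∧ (∀ k, x (k + N) = x k) ∧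
          ∀ k, ‖x k - y k‖ ≤ M * d := by
  obtain ⟨hR, hmono, hr0, hrlim, -, hDR, -, hDr⟩ := hreg
  set L : ℝ := 2 * C ^ 2 * (1 - lam)⁻¹ with hLdef
  have hL : 0 < L := by
    have : 0 < 1 - lam := sub_pos.2 hlam.2
    positivity
  obtain ⟨T, hT⟩ := exists_nat_gt (8 * L)
  have hT' : (0 : ℝ) < T := by linarith
  have hTpos : 0 < T := by exact_mod_cast hT'
  obtain ⟨ρ, hρr, hρ⟩ : ∃ ρ, r ρ < 1 / (4 * L) ∧ 0 < ρ :=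
    ((hrlim.eventually (gt_mem_nhds (by positivity : (0 : ℝ) < 1 / (4 * L)))).and
      self_mem_nhdsWithin).exists
  set K : ℝ := ∑ i ∈ Finset.range T, R ^ i with hK
  have hKpos : 0 < K := Finset.sum_pos (fun i _ => pow_pos hR i) ⟨0, Finset.mem_range.2 hTpos⟩
  have hDnear : ∀ a b : B, ‖a - b‖ ≤ ρ → ‖Df a - Df b‖ ≤ 1 / (4 * L) := fun a b hab => by
    have h1 := hDr b (a - b)
    rw [add_sub_cancel] at h1
    exact h1.trans ((hmono (norm_nonneg _) hρ.le hab).trans hρr.le)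
  have hlip : ∀ a b, ‖f a - f b‖ ≤ R * ‖a - b‖ := fun a b =>
    convex_univ.norm_image_sub_le_of_norm_hasFDerivWithin_le
      (fun x _ => (hf.2.2.1 x).hasFDerivWithinAt) (fun x _ => hDR x) (mem_univ b) (mem_univ a)
  refine ⟨L * 4, min (ρ / (4 * L)) (ρ / K), by positivity, by positivity, ?_⟩
  intro d hd0 hd N _ y hyN hyd
  have hd1 : L * (4 * d) ≤ ρ := by
    have := (lt_div_iff₀ (by positivity)).1 (hd.trans_le (min_le_left _ _))
    linarith
  have hd2 : K * d ≤ ρ := by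
    have := (lt_div_iff₀ hKpos).1 (hd.trans_le (min_le_right _ _))
    linarith
  have hbd := fun x w M => norm_windowSolution_le hC hlam hCL T x (w := w) (M := M)
  have hclose : ∀ (k : ℤ) (j : ℕ), j < T →
      ‖Df (f^[j] (y (k - j))) - Df (y k)‖ ≤ 1 / (4 * L) := by
    intro k j hj
    apply hDnear
    have h1 := norm_iterate_sub_le_of_pseudotrajectory hR.le hlip hyd j (k - j)
    rw [sub_add_cancel] at h1
    refine (h1.trans ?_).trans hd2
    gcongr
    exact Finset.sum_le_sum_of_subset_of_nonneg (Finset.range_mono hj.le)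
      fun i _ _ => (pow_pos hR i).le
  obtain ⟨v, hvbd, hvper, hv⟩ := exists_periodic_solution (N := N) (A := fun k => Df (y k))
    (S := windowAverage (windowSolution f fInv Df DfInv P Q T) T y)
    (h := fun k v => f (y k + v) - y (k + 1) - Df (y k) v) hL hd1
    (windowAverage_sub (windowSolution_sub f fInv Df DfInv P Q T) T y)
    (fun w hw => windowAverage_periodic hyN hw)
    (fun w M hw => norm_windowAverage_le hbd hTpos y hw)
    (fun w M hw k => by
      refine (norm_windowAverage_residual_le hbd hTpos
        (fun x w j hj => windowSolution_succ hf hCL.1 hj x w) hclose hw k).trans ?_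
      have hM : 0 ≤ M := (norm_nonneg _).trans (hw 0)
      gcongr
      have h1 : 2 * L / T ≤ 1 / 4 := by rw [div_le_iff₀ hT']; linarith
      have h2 : 1 / (4 * L) * L = 1 / 4 := by field_simp
      linarith)
    (fun k => by simp only [hyN])
    (fun k => by
      have : y (k + N + 1) = y (k + 1) := by rw [← hyN (k + 1)]; congr 1; ring
      simp only [hyN, this])
    (fun k => by
      simp only [add_zero, map_zero, sub_zero]
      rw [norm_sub_rev]
      exact hyd k)
    (fun k v v' hv hv' => by
      have hball : ∀ u : B, ‖u‖ ≤ ρ → y k + u ∈ Metric.closedBall (y k) ρ := fun u hu => by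
        simpa using hu
      have h1 := (convex_closedBall (y k) ρ).norm_image_sub_le_of_norm_hasFDerivWithin_le'
        (φ := Df (y k)) (fun x _ => (hf.2.2.1 x).hasFDerivWithinAt)
        (fun x hx => hDnear x (y k) (mem_closedBall_iff_norm.1 hx)) (hball v' hv') (hball v hv)
      rw [add_sub_add_left_eq_sub, map_sub] at h1
      refine le_of_eq_of_le (congrArg _ ?_) h1
      abel)
  refine ⟨fun k => y k + v k, fun k => ?_, fun k => ?_, fun k => ?_⟩
  · simp only [hv k]
    abel
  · simp only [hyN, hvper]
  · rw [add_sub_cancel_left, mul_assoc]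
    exact hvbd k

end
end
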